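/- Let 0<p<1 and let A' = (P_1,...,P_n) be n points on the Euclidean unit sphere S^{n-1} ⊆ R^n. Let Q_p(A') = p-conv{±e_1,...,±e_n, ±P_1,...,±P_n}. Then the Lebesgue measure satisfies |Q_p(A')| ≤ C(4n choose n) |B_{ℓ_p^n}| / 2^n ≤ C_p^n n^{-n/p} 2^{-n} for some constant C_p depending only on p, where B_{ℓ_p^n} is the unit ball of ℓ_p^n. -/

import Mathlib

open Finset

def PConvex {X : Type*} [AddCommGroup X] [Module ℝ X] (p : ℝ) (S : Set X) : Prop :=
  ∀ x ∈ S, ∀ y ∈ S, ∀ a b : ℝ, 0 ≤ a → 0 ≤ b → a ^ p + b ^ p = 1 → a • x + b • y ∈ S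

def pConvHull {X : Type*} [AddCommGroup X] [Module ℝ X] (p : ℝ) (A : Set X) : Set X :=
  ⋂₀ {S : Set X | PConvex p S ∧ A ⊆ S}

open MeasureTheory

theorem pConvHull_range_subset {X ι : Type*} [AddCommGroup X] [Module ℝ X] [Fintype ι]
    {p : ℝ} (hp0 : 0 < p) (hp1 : p ≤ 1) (v : ι → X) :
    pConvHull p (Set.range v) ⊆
      {x | ∃ a : ι → ℝ, (∀ i, 0 ≤ a i) ∧ ∑ i, a i ^ p ≤ 1 ∧ ∑ i, a i • v i = x} := by
  classical
  refine Set.sInter_subset_of_mem ⟨?_, ?_⟩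
  · rintro _ ⟨s, hs0, hs1, rfl⟩ _ ⟨t, ht0, ht1, rfl⟩ a b ha hb hab
    refine ⟨fun i => a * s i + b * t i,
      fun i => add_nonneg (mul_nonneg ha (hs0 i)) (mul_nonneg hb (ht0 i)), ?_, ?_⟩
    · calc ∑ i, (a * s i + b * t i) ^ p
          ≤ ∑ i, (a ^ p * s i ^ p + b ^ p * t i ^ p) := by
            refine Finset.sum_le_sum fun i _ => ?_
            rw [← Real.mul_rpow ha (hs0 i), ← Real.mul_rpow hb (ht0 i)]
            exact Real.rpow_add_le_add_rpow (mul_nonneg ha (hs0 i)) (mul_nonneg hb (ht0 i))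
              hp0.le hp1
        _ = a ^ p * ∑ i, s i ^ p + b ^ p * ∑ i, t i ^ p := by
            rw [Finset.sum_add_distrib, Finset.mul_sum, Finset.mul_sum]
        _ ≤ a ^ p * 1 + b ^ p * 1 := by gcongr
        _ = 1 := by rw [mul_one, mul_one, hab]
    · simp only [add_smul, mul_smul, Finset.sum_add_distrib, Finset.smul_sum]
  · rintro _ ⟨j, rfl⟩
    refine ⟨Pi.single j 1, fun i => ?_, ?_, ?_⟩
    · by_cases h : i = j
      · subst h; simp
      · simp [h]
    · rw [Finset.sum_eq_single j] <;> simp +contextual [hp0.ne']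
    · rw [Finset.sum_eq_single j] <;> simp +contextual

/-- The tangent line of the concave function `x ↦ x ^ p` lies above its graph. -/
theorem Real.rpow_add_mul_le {p a : ℝ} (hp0 : 0 < p) (hp1 : p ≤ 1) (ha : 0 < a) {h : ℝ}
    (hh : 0 ≤ a + h) : (a + h) ^ p ≤ a ^ p + p * (a ^ (p - 1) * h) := by
  have h1 : -1 ≤ h / a := by rw [le_div_iff₀ ha]; linarith
  have h2 : a + h = a * (1 + h / a) := by field_simp
  rw [h2, Real.mul_rpow ha.le (by linarith), Real.rpow_sub_one ha.ne']
  calc a ^ p * (1 + h / a) ^ p ≤ a ^ p * (1 + p * (h / a)) := by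
        gcongr
        exact rpow_one_add_le_one_add_mul_self h1 hp0.le hp1
    _ = _ := by ring

/-- One step of the `p`-convex Carathéodory reduction: a dependency among the vectors in use
allows removing one of them. -/
theorem exists_coeff_eq_zero_of_not_linearIndepOn {X ι : Type*} [AddCommGroup X] [Module ℝ X]
    {p : ℝ} (hp0 : 0 < p) (hp1 : p ≤ 1) (v : ι → X) (s : Finset ι) (a : ι → ℝ)
    (ha : ∀ i ∈ s, 0 < a i) (hs : ¬ LinearIndepOn ℝ v (s : Set ι)) :
    ∃ b : ι → ℝ, (∀ i ∈ s, 0 ≤ b i) ∧ (∃ i ∈ s, b i = 0) ∧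
      ∑ i ∈ s, b i ^ p ≤ ∑ i ∈ s, a i ^ p ∧ ∑ i ∈ s, b i • v i = ∑ i ∈ s, a i • v i := by
  classical
  obtain ⟨d, hdv, hd0, hd1⟩ : ∃ d : ι → ℝ, ∑ i ∈ s, d i • v i = 0 ∧ (∃ i ∈ s, d i ≠ 0) ∧
      ∑ i ∈ s, a i ^ (p - 1) * d i ≤ 0 := by
    rw [linearIndepOn_finset_iff] at hs
    push Not at hs
    obtain ⟨d, hd, hne⟩ := hs
    rcases le_total (∑ i ∈ s, a i ^ (p - 1) * d i) 0 with h | h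
    · exact ⟨d, hd, hne, h⟩
    · exact ⟨-d, by simp [hd], by simpa using hne, by simpa using h⟩
  have hneg : (s.filter fun i => d i < 0).Nonempty := by
    by_contra hcon
    have hnn : ∀ i ∈ s, 0 ≤ d i := by
      intro i hi
      by_contra h
      exact hcon ⟨i, by simp [hi, not_le.1 h]⟩
    obtain ⟨i, hi, hne⟩ := hd0
    have : 0 < ∑ i ∈ s, a i ^ (p - 1) * d i :=
      Finset.sum_pos' (fun i hi => mul_nonneg (Real.rpow_nonneg (ha i hi).le _) (hnn i hi))
        ⟨i, hi, mul_pos (Real.rpow_pos_of_pos (ha i hi) _) ((hnn i hi).lt_of_ne hne.symm)⟩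
    linarith
  obtain ⟨j, hj, hmin⟩ := Finset.exists_min_image _ (fun i => a i / -d i) hneg
  rw [Finset.mem_filter] at hj
  obtain ⟨hjs, hjd⟩ := hj
  have ht0 : 0 ≤ a j / -d j := div_nonneg (ha j hjs).le (by linarith)
  set t := a j / -d j with ht
  have hb : ∀ i ∈ s, 0 ≤ a i + t * d i := by
    intro i hi
    rcases le_or_gt 0 (d i) with h | h
    · exact add_nonneg (ha i hi).le (mul_nonneg ht0 h)
    · have := hmin i (by simp [hi, h])
      rw [le_div_iff₀ (by linarith)] at this
      linarith
  refine ⟨fun i => a i + t * d i, hb, ⟨j, hjs, ?_⟩, ?_, ?_⟩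
  · simp only [ht]
    field_simp [hjd.ne]
    ring
  · calc ∑ i ∈ s, (a i + t * d i) ^ p
        ≤ ∑ i ∈ s, (a i ^ p + p * (a i ^ (p - 1) * (t * d i))) :=
          Finset.sum_le_sum fun i hi => Real.rpow_add_mul_le hp0 hp1 (ha i hi) (hb i hi)
      _ = ∑ i ∈ s, a i ^ p + p * t * ∑ i ∈ s, a i ^ (p - 1) * d i := by
          rw [Finset.sum_add_distrib, Finset.mul_sum]
          congr 1
          exact Finset.sum_congr rfl fun i _ => by ring
      _ ≤ ∑ i ∈ s, a i ^ p := by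
          have := mul_nonpos_of_nonneg_of_nonpos (mul_nonneg hp0.le ht0) hd1
          linarith
  · simp only [add_smul, mul_smul, Finset.sum_add_distrib, ← Finset.smul_sum, hdv, smul_zero,
      add_zero]

/-- The `p`-convex Carathéodory theorem: linearly independent vectors suffice. -/
theorem exists_linearIndepOn_of_sum_rpow_le {X ι : Type*} [AddCommGroup X] [Module ℝ X]
    {p : ℝ} (hp0 : 0 < p) (hp1 : p ≤ 1) (v : ι → X) {c : ℝ} (s : Finset ι) :
    ∀ a : ι → ℝ, (∀ i ∈ s, 0 ≤ a i) → ∑ i ∈ s, a i ^ p ≤ c →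
      ∃ t ⊆ s, LinearIndepOn ℝ v (t : Set ι) ∧ ∃ b : ι → ℝ, (∀ i ∈ t, 0 ≤ b i) ∧
        ∑ i ∈ t, b i ^ p ≤ c ∧ ∑ i ∈ t, b i • v i = ∑ i ∈ s, a i • v i := by
  classical
  induction s using Finset.strongInduction with
  | H s ih =>
    intro a ha hac
    have remove : ∀ b : ι → ℝ, (∀ i ∈ s, 0 ≤ b i) → (∃ i ∈ s, b i = 0) →
        ∑ i ∈ s, b i ^ p ≤ c → ∑ i ∈ s, b i • v i = ∑ i ∈ s, a i • v i →
        ∃ t ⊆ s, LinearIndepOn ℝ v (t : Set ι) ∧ ∃ b : ι → ℝ, (∀ i ∈ t, 0 ≤ b i) ∧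
          ∑ i ∈ t, b i ^ p ≤ c ∧ ∑ i ∈ t, b i • v i = ∑ i ∈ s, a i • v i := by
      rintro b hb ⟨j, hj, hbj⟩ hbc hbv
      obtain ⟨t, hts, hti, b', hb'⟩ := ih (s.erase j) (Finset.erase_ssubset hj) b
        (fun i hi => hb i (Finset.mem_of_mem_erase hi))
        (by rwa [Finset.sum_erase _ (by rw [hbj, Real.zero_rpow hp0.ne'])])
      rw [Finset.sum_erase _ (by rw [hbj, zero_smul]), hbv] at hb'
      exact ⟨t, hts.trans (Finset.erase_subset _ _), hti, b', hb'⟩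
    by_cases h0 : ∃ i ∈ s, a i = 0
    · exact remove a ha h0 hac rfl
    by_cases hs : LinearIndepOn ℝ v (s : Set ι)
    · exact ⟨s, subset_rfl, hs, a, ha, hac, rfl⟩
    push Not at h0
    obtain ⟨b, hb, hb0, hbp, hbv⟩ := exists_coeff_eq_zero_of_not_linearIndepOn hp0 hp1 v s a
      (fun i hi => (ha i hi).lt_of_ne (h0 i hi).symm) hs
    exact remove b hb hb0 (hbp.trans hac) hbv

theorem pConvHull_range_subset_iUnion {X ι : Type*} [AddCommGroup X] [Module ℝ X]
    [FiniteDimensional ℝ X] [Fintype ι] {p : ℝ} (hp0 : 0 < p) (hp1 : p ≤ 1) (v : ι → X) {n : ℕ}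
    (hn : Module.finrank ℝ X = n) (hι : n ≤ Fintype.card ι) :
    pConvHull p (Set.range v) ⊆ ⋃ s ∈ Finset.powersetCard n (Finset.univ : Finset ι),
      {x | ∃ a : s → ℝ, (∀ i, 0 ≤ a i) ∧ ∑ i, a i ^ p ≤ 1 ∧ ∑ i, a i • v i = x} := by
  classical
  intro x hx
  obtain ⟨a, ha, hap, rfl⟩ := pConvHull_range_subset hp0 hp1 v hx
  obtain ⟨t, -, hti, b, hb, hbp, hbv⟩ :=
    exists_linearIndepOn_of_sum_rpow_le hp0 hp1 v Finset.univ a (fun i _ => ha i) hap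
  have htn : t.card ≤ n := by
    have := LinearIndependent.fintype_card_le_finrank (R := ℝ) hti
    rw [hn] at this
    simpa using this
  obtain ⟨s, hts, hsn⟩ := Finset.exists_superset_card_eq htn hι
  simp only [Set.mem_iUnion]
  refine ⟨s, by simp [Finset.mem_powersetCard, hsn],
    fun i => if (i : ι) ∈ t then b i else 0, fun i => ?_, ?_, ?_⟩
  · dsimp only
    split_ifs with h
    exacts [hb _ h, le_rfl]
  · rw [Finset.sum_coe_sort s fun i => (if i ∈ t then b i else 0) ^ p]
    rw [← Finset.sum_subset hts fun i _ hi => by simp [hi, hp0.ne']]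
    exact (Finset.sum_congr rfl fun i hi => by simp [hi]).trans_le hbp
  · rw [Finset.sum_coe_sort s fun i => (if i ∈ t then b i else 0) • v i]
    rw [← Finset.sum_subset hts fun i _ hi => by simp [hi], ← hbv]
    exact Finset.sum_congr rfl fun i hi => by simp [hi]

/-- Hadamard's inequality for the change of volume of a linear map. -/
theorem abs_det_constr_le_one {n : ℕ} (w : Fin n → EuclideanSpace ℝ (Fin n))
    (hw : ∀ i, ‖w i‖ = 1) :
    |LinearMap.det ((EuclideanSpace.basisFun (Fin n) ℝ).toBasis.constr ℝ w)| ≤ 1 := by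
  set b := EuclideanSpace.basisFun (Fin n) ℝ
  have : Fact (Module.finrank ℝ (EuclideanSpace ℝ (Fin n)) = n) := ⟨by simp⟩
  have h := b.toBasis.orientation.abs_volumeForm_apply_le w
  rw [b.toBasis.orientation.volumeForm_robust b rfl] at h
  have hc : (b.toBasis.constr ℝ w) ∘ b.toBasis = w :=
    funext fun i => b.toBasis.constr_basis ℝ w i
  rw [← hc, Module.Basis.det_comp, Module.Basis.det_self, mul_one] at h
  simpa [hc, hw] using h

theorem volume_orthant_image_le {ι : Type*} [Fintype ι] {n : ℕ} (hι : Fintype.card ι = n) (p : ℝ)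
    (w : ι → EuclideanSpace ℝ (Fin n)) (hw : ∀ i, ‖w i‖ = 1) :
    volume {x | ∃ a : ι → ℝ, (∀ i, 0 ≤ a i) ∧ ∑ i, a i ^ p ≤ 1 ∧ ∑ i, a i • w i = x} ≤
      volume {x : EuclideanSpace ℝ (Fin n) | (∀ i, 0 ≤ x i) ∧ ∑ i, x i ^ p ≤ 1} := by
  classical
  let e : Fin n ≃ ι := (Fintype.equivFinOfCardEq hι).symm
  set L := (EuclideanSpace.basisFun (Fin n) ℝ).toBasis.constr ℝ (w ∘ e) with hL
  calc _ ≤ volume (L '' {x | (∀ i, 0 ≤ x i) ∧ ∑ i, x i ^ p ≤ 1}) := by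
        refine measure_mono ?_
        rintro _ ⟨a, ha, hap, rfl⟩
        refine ⟨WithLp.toLp 2 (a ∘ e), ⟨fun i => ha _, ?_⟩, ?_⟩
        · simpa [e.sum_comp fun i => a i ^ p] using hap
        · rw [hL, Module.Basis.constr_apply_fintype]
          simpa using e.sum_comp fun i => a i • w i
    _ = ENNReal.ofReal |LinearMap.det L| * _ := Measure.addHaar_image_linearMap _ _ _
    _ ≤ 1 * _ := by
        gcongr
        exact ENNReal.ofReal_le_one.2 (abs_det_constr_le_one _ fun i => hw _)
    _ = _ := one_mul _

theorem measurableSet_sum_abs_rpow_le {ι : Type*} [Fintype ι] (p : ℝ) :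
    MeasurableSet {x : ι → ℝ | ∑ i, |x i| ^ p ≤ 1} :=
  measurableSet_le (f := fun x : ι → ℝ => ∑ i, |x i| ^ p)
    (by simp only [← Real.norm_eq_abs]; fun_prop) measurable_const

theorem measurableSet_orthant_sum_rpow_le {ι : Type*} [Fintype ι] (p : ℝ) :
    MeasurableSet {x : ι → ℝ | (∀ i, 0 ≤ x i) ∧ ∑ i, x i ^ p ≤ 1} := by
  refine MeasurableSet.inter (s₁ := {x : ι → ℝ | ∀ i, 0 ≤ x i}) ?_
    (measurableSet_le (f := fun x : ι → ℝ => ∑ i, x i ^ p) (by fun_prop) measurable_const)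
  simp only [Set.ofPred_forall]
  exact MeasurableSet.iInter fun i => measurableSet_le measurable_const (measurable_pi_apply i)

theorem two_pow_mul_volume_orthant_le {ι : Type*} [Fintype ι] (p : ℝ) :
    2 ^ Fintype.card ι * volume {x : ι → ℝ | (∀ i, 0 ≤ x i) ∧ ∑ i, x i ^ p ≤ 1} ≤
      volume {x : ι → ℝ | ∑ i, |x i| ^ p ≤ 1} := by
  classical
  let f : (ι → Bool) → (ι → ℝ) → (ι → ℝ) := fun s x i => if s i then x i else -x i
  set T := {x : ι → ℝ | (∀ i, 0 ≤ x i) ∧ ∑ i, x i ^ p ≤ 1}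
  have hTm : MeasurableSet T := measurableSet_orthant_sum_rpow_le p
  have hf : ∀ s, MeasurePreserving (f s) volume volume := by
    intro s
    refine volume_preserving_pi (f := fun i y => if s i then y else -y) fun i => ?_
    cases s i
    · simpa using Measure.measurePreserving_neg (volume : Measure ℝ)
    · exact MeasurePreserving.id (volume : Measure ℝ)
  have hdisj : Pairwise (Function.onFun (AEDisjoint volume) fun s => f s ⁻¹' T) := by
    intro s t hst
    obtain ⟨i, hi⟩ := Function.ne_iff.1 hst
    refine measure_mono_null (t := {x : ι → ℝ | x i = 0}) ?_
      (Measure.pi_hyperplane (fun _ => volume) i 0)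
    rintro x ⟨⟨hx, -⟩, ⟨hx', -⟩⟩
    have h1 := hx i
    have h2 := hx' i
    simp only [f] at h1 h2
    rw [Set.mem_ofPred_eq]
    cases hs : s i <;> cases ht : t i <;> simp_all <;> linarith
  calc 2 ^ Fintype.card ι * volume T
      = ∑ s : ι → Bool, volume (f s ⁻¹' T) := by
        simp [fun s => (hf s).measure_preimage hTm.nullMeasurableSet]
    _ = volume (⋃ s, f s ⁻¹' T) := by
        rw [measure_iUnion₀ hdisj fun s => ((hf s).measurable hTm).nullMeasurableSet,
          tsum_fintype]
    _ ≤ _ := by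
        refine measure_mono (Set.iUnion_subset fun s x hx => ?_)
        refine le_trans (Finset.sum_le_sum fun i _ => ?_) hx.2
        have h1 := hx.1 i
        rw [← abs_of_nonneg h1]
        simp only [f]
        split_ifs <;> simp

theorem integral_exp_neg_mul_abs_rpow {p b : ℝ} (hp : 0 < p) (hb : 0 < b) :
    ∫ x : ℝ, Real.exp (-b * |x| ^ p) = 2 * (b ^ (-1 / p) * Real.Gamma (1 / p + 1)) := by
  rw [integral_comp_abs (f := fun x => Real.exp (-b * x ^ p)), integral_exp_neg_mul_rpow hp hb]

theorem integrable_exp_neg_mul_abs_rpow {p b : ℝ} (hp : 0 < p) (hb : 0 < b) :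
    Integrable fun x : ℝ => Real.exp (-b * |x| ^ p) := by
  refine Integrable.of_integral_ne_zero ?_
  rw [integral_exp_neg_mul_abs_rpow hp hb]
  have := Real.Gamma_pos_of_pos (s := 1 / p + 1) (by positivity)
  positivity

/-- Exponential Markov bound for the volume of the unit ball of `ℓ_p`. -/
theorem volume_sum_abs_rpow_le {ι : Type*} [Fintype ι] {p b : ℝ} (hp : 0 < p) (hb : 0 < b) :
    volume {x : ι → ℝ | ∑ i, |x i| ^ p ≤ 1} ≤ ENNReal.ofReal
      (Real.exp b * (2 * (b ^ (-1 / p) * Real.Gamma (1 / p + 1))) ^ Fintype.card ι) := by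
  have hint : Integrable fun x : ι → ℝ => ∏ i, Real.exp (-b * |x i| ^ p) :=
    Integrable.fintype_prod (f := fun _ y => Real.exp (-b * |y| ^ p))
      fun _ => integrable_exp_neg_mul_abs_rpow hp hb
  have hset : {x : ι → ℝ | ∑ i, |x i| ^ p ≤ 1} =
      {x | Real.exp (-b) ≤ ∏ i, Real.exp (-b * |x i| ^ p)} := by
    ext x
    rw [Set.mem_ofPred_eq, Set.mem_ofPred_eq, ← Real.exp_sum, ← Finset.mul_sum, Real.exp_le_exp]
    constructor <;> intro h <;> nlinarith
  have hfin : volume {x : ι → ℝ | ∑ i, |x i| ^ p ≤ 1} ≠ ⊤ := by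
    rw [hset]
    exact (hint.measure_ge_lt_top (Real.exp_pos _)).ne
  have hmarkov := mul_meas_ge_le_integral_of_nonneg
    (ae_of_all _ fun x => Finset.prod_nonneg fun i _ => (Real.exp_pos _).le) hint (Real.exp (-b))
  rw [← hset, integral_fintype_prod_volume_eq_pow (fun y : ℝ => Real.exp (-b * |y| ^ p)),
    integral_exp_neg_mul_abs_rpow hp hb, Real.exp_neg, inv_mul_le_iff₀ (Real.exp_pos _)] at hmarkov
  rw [← ENNReal.ofReal_toReal hfin]
  exact ENNReal.ofReal_le_ofReal hmarkov

theorem EuclideanSpace.volume_setOf_ofLp_mem {ι : Type*} [Fintype ι] {S : Set (ι → ℝ)}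
    (hS : MeasurableSet S) : volume {x : EuclideanSpace ℝ ι | x.ofLp ∈ S} = volume S :=
  (PiLp.volume_preserving_ofLp ι).measure_preimage hS.nullMeasurableSet

theorem volume_pConvHull_range_le {ι : Type*} [Fintype ι] {n : ℕ} (hι : n ≤ Fintype.card ι)
    {p : ℝ} (hp0 : 0 < p) (hp1 : p ≤ 1) (v : ι → EuclideanSpace ℝ (Fin n))
    (hv : ∀ i, ‖v i‖ = 1) :
    volume (pConvHull p (Set.range v)) ≤ (Fintype.card ι).choose n *
      (volume {x : EuclideanSpace ℝ (Fin n) | ∑ i, |x i| ^ p ≤ 1} / 2 ^ n) := by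
  have horth : volume {x : EuclideanSpace ℝ (Fin n) | (∀ i, 0 ≤ x i) ∧ ∑ i, x i ^ p ≤ 1} ≤
      volume {x : EuclideanSpace ℝ (Fin n) | ∑ i, |x i| ^ p ≤ 1} / 2 ^ n := by
    rw [ENNReal.le_div_iff_mul_le (by simp) (by simp), mul_comm]
    have h := two_pow_mul_volume_orthant_le (ι := Fin n) p
    rw [Fintype.card_fin] at h
    convert h using 2
    · exact EuclideanSpace.volume_setOf_ofLp_mem (measurableSet_orthant_sum_rpow_le p)
    · exact EuclideanSpace.volume_setOf_ofLp_mem (measurableSet_sum_abs_rpow_le p)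
  calc volume (pConvHull p (Set.range v))
      ≤ ∑ s ∈ Finset.powersetCard n (Finset.univ : Finset ι),
          volume {x | ∃ a : s → ℝ, (∀ i, 0 ≤ a i) ∧ ∑ i, a i ^ p ≤ 1 ∧ ∑ i, a i • v i = x} :=
        (measure_mono (pConvHull_range_subset_iUnion hp0 hp1 v (by simp) hι)).trans
          (measure_biUnion_finset_le _ _)
    _ ≤ ∑ s ∈ Finset.powersetCard n (Finset.univ : Finset ι),
          volume {x : EuclideanSpace ℝ (Fin n) | ∑ i, |x i| ^ p ≤ 1} / 2 ^ n := by
        refine Finset.sum_le_sum fun s hs => (volume_orthant_image_le ?_ p (fun i : s => v i)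
          fun i => hv i).trans horth
        simpa using (Finset.mem_powersetCard.1 hs).2
    _ = _ := by simp

theorem volume_Qp_bound (p : ℝ) (hp0 : 0 < p) (hp1 : p < 1) :
    ∃ C : ℝ, 0 < C ∧ ∀ (n : ℕ), 0 < n →
      ∀ P : Fin n → EuclideanSpace ℝ (Fin n), (∀ i, ‖P i‖ = 1) →
      (MeasureTheory.volume (pConvHull p
          ((Set.range fun i => EuclideanSpace.single i (1 : ℝ)) ∪
           (Set.range fun i => -EuclideanSpace.single i (1 : ℝ)) ∪
           Set.range P ∪ Set.range (fun i => -P i)))).toReal ≤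
        (Nat.choose (4 * n) n : ℝ) *
          (MeasureTheory.volume
            {x : EuclideanSpace ℝ (Fin n) | (∑ i, |x i| ^ p) ≤ 1}).toReal / 2 ^ n ∧
      (Nat.choose (4 * n) n : ℝ) *
          (MeasureTheory.volume
            {x : EuclideanSpace ℝ (Fin n) | (∑ i, |x i| ^ p) ≤ 1}).toReal / 2 ^ n ≤
        C ^ n * (n : ℝ) ^ (-(n : ℝ) / p) * 2⁻¹ ^ n := by
  set γ := Real.Gamma (1 / p + 1)
  have hγ0 : 0 < γ := Real.Gamma_pos_of_pos (by positivity)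
  refine ⟨2 ^ 5 * Real.exp 1 * γ, by positivity, fun n hn P hP => ?_⟩
  have hn0 : (0 : ℝ) < n := Nat.cast_pos.2 hn
  have hball : volume {x : EuclideanSpace ℝ (Fin n) | ∑ i, |x i| ^ p ≤ 1} ≤ ENNReal.ofReal
      (Real.exp n * (2 * ((n : ℝ) ^ (-1 / p) * γ)) ^ n) := by
    have h := volume_sum_abs_rpow_le (ι := Fin n) hp0 hn0
    rw [Fintype.card_fin] at h
    exact (EuclideanSpace.volume_setOf_ofLp_mem (measurableSet_sum_abs_rpow_le p)).trans_le h
  have hfin := (hball.trans_lt ENNReal.ofReal_lt_top).ne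
  constructor
  · let v : (Fin n ⊕ Fin n) ⊕ (Fin n ⊕ Fin n) → EuclideanSpace ℝ (Fin n) :=
      Sum.elim (Sum.elim (fun i => EuclideanSpace.single i 1) fun i => -EuclideanSpace.single i 1)
        (Sum.elim P fun i => -P i)
    have hcard : Fintype.card ((Fin n ⊕ Fin n) ⊕ (Fin n ⊕ Fin n)) = 4 * n := by
      simp only [Fintype.card_sum, Fintype.card_fin]
      ring
    have hrange : Set.range v = (Set.range fun i => EuclideanSpace.single i (1 : ℝ)) ∪
        (Set.range fun i => -EuclideanSpace.single i (1 : ℝ)) ∪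
        Set.range P ∪ Set.range (fun i => -P i) := by
      simp only [v, Set.Sum.elim_range, Set.union_assoc]
    have hv : ∀ i, ‖v i‖ = 1 := by
      rintro ((i | i) | (i | i)) <;> simp [v, hP]
    have h := volume_pConvHull_range_le (by omega) hp0 hp1.le v hv
    rw [hcard, hrange] at h
    refine (ENNReal.toReal_mono ?_ h).trans_eq ?_
    · exact ENNReal.mul_ne_top (by simp) (ENNReal.div_ne_top hfin (by simp))
    · simp [mul_div_assoc]
  · have hpow : ((n : ℝ) ^ (-1 / p)) ^ n = (n : ℝ) ^ (-(n : ℝ) / p) := by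
      rw [← Real.rpow_natCast, ← Real.rpow_mul hn0.le]
      congr 1
      ring
    have hchoose : ((4 * n).choose n : ℝ) ≤ (2 ^ 4) ^ n := by
      rw [← pow_mul]
      exact_mod_cast Nat.choose_le_two_pow (4 * n) n
    calc _ ≤ (2 ^ 4) ^ n * (Real.exp n * (2 * ((n : ℝ) ^ (-1 / p) * γ)) ^ n) / 2 ^ n := by
          gcongr
          exact ENNReal.toReal_le_of_le_ofReal (by positivity) hball
      _ = _ := by
          rw [← Real.exp_one_pow n, ← hpow, inv_pow, div_eq_mul_inv, pow_succ 2 4]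
          simp only [mul_pow]
          ring
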